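/- arXiv:1403.4802 — 5 statements merged into one kernel-verified Lean document; each statement's English description precedes it below -/
import Mathlib

section
/- Let λ > 0 be an irrational real number and c > 0 a real number. Let U be a connected open neighborhood of (0,0) in ℂ², and let f : ℂ² → ℂ be complex analytic on U. If ‖f(x,y)‖ ≤ ‖f(0,0)‖ for every point (x,y) ∈ U satisfying ‖y‖ = c·‖x‖^λ, then f is constant on U. -/
/-- Maximum Modulus Principle for the model nodal separator
`S_c = {(x,y) : ‖y‖ = c‖x‖^λ}` (λ > 0 irrational): if a function holomorphic on a
connected open neighborhood `U` of the origin in `ℂ²` has `‖f‖` bounded on `S_c ∩ U`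
by its value at the origin, then `f` is constant on `U`. -/
theorem nodal_separator_maximum_modulus
    (lam c : ℝ) (hlam : 0 < lam) (hirr : Irrational lam) (hc : 0 < c)
    (U : Set (ℂ × ℂ)) (hUopen : IsOpen U) (hUconn : IsConnected U)
    (h0 : ((0, 0) : ℂ × ℂ) ∈ U)
    (f : ℂ × ℂ → ℂ) (hf : AnalyticOnNhd ℂ f U)
    (hbound : ∀ z ∈ U, ‖z.2‖ = c * ‖z.1‖ ^ lam → ‖f z‖ ≤ ‖f (0, 0)‖) :
    ∀ z ∈ U, f z = f (0, 0) := by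
  obtain ⟨ε, hε, hball⟩ := Metric.isOpen_iff.1 hUopen _ h0
  have hmem : ∀ x y : ℂ, ‖x‖ < ε → ‖y‖ < ε → ((x, y) : ℂ × ℂ) ∈ U := by
    intro x y hx hy
    apply hball
    rw [Metric.mem_ball, Prod.dist_eq]
    simpa using And.intro hx hy
  -- choose the radius
  obtain ⟨r, hr0, hrε, hrc⟩ : ∃ r : ℝ, 0 < r ∧ r < ε ∧ c * r ^ lam < ε := by
    have hcont : ContinuousAt (fun r : ℝ => c * r ^ lam) 0 :=
      continuousAt_const.mul (Real.continuousAt_rpow_const _ _ (Or.inr hlam.le))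
    have h1 : ∀ᶠ r : ℝ in nhds 0, c * r ^ lam < ε := by
      apply hcont.eventually_lt continuousAt_const
      simpa [Real.zero_rpow hlam.ne'] using hε
    have h2 : ∀ᶠ r : ℝ in nhds 0, r < ε := gt_mem_nhds hε
    have h3 : ∀ᶠ r : ℝ in nhdsWithin 0 (Set.Ioi 0), 0 < r := self_mem_nhdsWithin
    obtain ⟨r, ha, hb, hd⟩ :=
      (h3.and ((h2.filter_mono nhdsWithin_le_nhds).and
        (h1.filter_mono nhdsWithin_le_nhds))).exists
    exact ⟨r, ha, hb, hd⟩
  set R : ℝ := c * r ^ lam with hR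
  have hR0 : 0 < R := mul_pos hc (Real.rpow_pos_of_pos hr0 _)
  -- maximum principle in one variable on closed discs
  have key : ∀ (g : ℂ → ℂ) (ρ M : ℝ), 0 < ρ →
      (∀ w : ℂ, ‖w‖ ≤ ρ → DifferentiableAt ℂ g w) →
      (∀ w : ℂ, ‖w‖ = ρ → ‖g w‖ ≤ M) → ∀ w : ℂ, ‖w‖ ≤ ρ → ‖g w‖ ≤ M := by
    intro g ρ M hρ hd hb w hw
    have hcl : closure (Metric.ball (0 : ℂ) ρ) = Metric.closedBall 0 ρ :=
      closure_ball _ hρ.ne'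
    refine Complex.norm_le_of_forall_mem_frontier_norm_le
      (U := Metric.ball (0 : ℂ) ρ) Metric.isBounded_ball ?_ ?_ ?_
    · apply DifferentiableOn.diffContOnCl
      rw [hcl]
      intro z hz
      exact (hd z (by simpa using hz)).differentiableWithinAt
    · intro z hz
      rw [frontier_ball _ hρ.ne'] at hz
      exact hb z (by simpa using hz)
    · rw [hcl]
      simpa using hw
  have hd : ∀ x y : ℂ, ‖x‖ ≤ r → ‖y‖ ≤ R → DifferentiableAt ℂ f (x, y) := fun x y hx hy =>
    (hf _ (hmem x y (hx.trans_lt hrε) (hy.trans_lt hrc))).differentiableAt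
  have step1 : ∀ y : ℂ, ‖y‖ = R → ∀ x : ℂ, ‖x‖ ≤ r → ‖f (x, y)‖ ≤ ‖f (0, 0)‖ := by
    intro y hy
    refine key (fun x => f (x, y)) r _ hr0 ?_ ?_
    · intro w hw
      exact DifferentiableAt.comp (f := fun x : ℂ => (x, y)) w (hd w y hw hy.le)
        (differentiableAt_id.prodMk (differentiableAt_const y))
    · intro w hw
      exact hbound (w, y) (hmem w y (hw.trans_lt hrε) (hy.trans_lt hrc)) (by simp [hw, hy, hR])
  have step2 : ∀ x : ℂ, ‖x‖ ≤ r → ∀ y : ℂ, ‖y‖ ≤ R → ‖f (x, y)‖ ≤ ‖f (0, 0)‖ := by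
    intro x hx
    refine key (fun y => f (x, y)) R _ hR0 ?_ ?_
    · intro w hw
      exact DifferentiableAt.comp (f := fun y : ℂ => (x, y)) w (hd x w hx hw)
        ((differentiableAt_const x).prodMk differentiableAt_id)
    · intro w hw
      exact step1 w hw x hx
  have hmax : IsLocalMax (norm ∘ f) (0, 0) := by
    have hn : Metric.ball ((0, 0) : ℂ × ℂ) (min r R) ∈ nhds ((0, 0) : ℂ × ℂ) :=
      Metric.ball_mem_nhds _ (lt_min hr0 hR0)
    filter_upwards [hn] with z hz
    rw [Metric.mem_ball, Prod.dist_eq, max_lt_iff, dist_zero_right, dist_zero_right] at hz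
    exact step2 z.1 (hz.1.le.trans (min_le_left _ _)) z.2 (hz.2.le.trans (min_le_right _ _))
  have hdiff : ∀ᶠ z in nhds ((0, 0) : ℂ × ℂ), DifferentiableAt ℂ f z := by
    filter_upwards [hUopen.mem_nhds h0] with z hz
    exact (hf z hz).differentiableAt
  have hev := Complex.eventually_eq_of_isLocalMax_norm hdiff hmax
  intro z hz
  exact hf.eqOn_of_preconnected_of_eventuallyEq analyticOnNhd_const
    hUconn.isPreconnected h0 hev hz
end

section
/- Let λ > 0 be an irrational real number and c > 0 a real number. Let U be a connected open neighborhood of (0,0) in ℂ², and let f : ℂ² → ℂ be complex analytic on U. If f(x,y) = 0 for every point (x,y) ∈ U satisfying ‖y‖ = c·‖x‖^λ, then f is identically zero on U. -/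
/-- A function analytic near a closed disc and zero on its boundary circle is zero on the disc. -/
theorem disc_zero_of_circle_zero (g : ℂ → ℂ) (ρ : ℝ) (hρ : 0 < ρ)
    (hg : ∀ x, ‖x‖ ≤ ρ → DifferentiableAt ℂ g x) (hz : ∀ x, ‖x‖ = ρ → g x = 0) :
    ∀ x, ‖x‖ ≤ ρ → g x = 0 := by
  intro x hx
  have hd : DiffContOnCl ℂ g (Metric.ball 0 ρ) := by
    apply DifferentiableOn.diffContOnCl
    intro y hy
    rw [closure_ball _ hρ.ne'] at hy
    exact (hg y (by simpa using hy)).differentiableWithinAt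
  have h := Complex.eqOn_closure_of_eqOn_frontier (g := fun _ => (0 : ℂ)) Metric.isBounded_ball hd
    diffContOnCl_const (by
      intro y hy
      rw [frontier_ball _ hρ.ne'] at hy
      exact hz y (by simpa using hy))
  rw [closure_ball _ hρ.ne'] at h
  exact h (by simpa using hx)

/-- Uniqueness-set property of the nodal separator: a function holomorphic on a
connected open neighborhood `U` of the origin in `ℂ²` vanishing on
`{(x,y) : ‖y‖ = c‖x‖^λ} ∩ U` (λ > 0 irrational, c > 0) vanishes identically on `U`. -/
theorem nodal_separator_zero_set
    (lam c : ℝ) (hlam : 0 < lam) (hirr : Irrational lam) (hc : 0 < c)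
    (U : Set (ℂ × ℂ)) (hUopen : IsOpen U) (hUconn : IsConnected U)
    (h0 : ((0, 0) : ℂ × ℂ) ∈ U)
    (f : ℂ × ℂ → ℂ) (hf : AnalyticOnNhd ℂ f U)
    (hzero : ∀ z ∈ U, ‖z.2‖ = c * ‖z.1‖ ^ lam → f z = 0) :
    ∀ z ∈ U, f z = 0 := by
  obtain ⟨r, hr, hball⟩ := Metric.isOpen_iff.1 hUopen _ h0
  have hmem : ∀ x y : ℂ, ‖x‖ < r → ‖y‖ < r → (x, y) ∈ U := by
    intro x y hx hy
    apply hball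
    rw [Metric.mem_ball, Prod.dist_eq]
    simpa using ⟨hx, hy⟩
  have hcont : Filter.Tendsto (fun t : ℝ => c * t ^ lam) (nhds 0) (nhds 0) := by
    have h : ContinuousAt (fun t : ℝ => c * t ^ lam) 0 :=
      continuousAt_const.mul (Real.continuousAt_rpow_const _ _ (Or.inr hlam.le))
    simpa [ContinuousAt, Real.zero_rpow hlam.ne'] using h
  have hev : ∀ᶠ t : ℝ in nhdsWithin 0 (Set.Ioi 0), (c * t ^ lam < r ∧ t < r) ∧ 0 < t :=
    (((hcont.eventually (gt_mem_nhds hr)).and (gt_mem_nhds hr)).filter_mono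
      nhdsWithin_le_nhds).and self_mem_nhdsWithin
  obtain ⟨ρ, ⟨hσr, hρr⟩, hρ⟩ := hev.exists
  have hσ : 0 < c * ρ ^ lam := mul_pos hc (Real.rpow_pos_of_pos hρ _)
  have h1 : ∀ x, ‖x‖ = ρ → ∀ y, ‖y‖ ≤ c * ρ ^ lam → f (x, y) = 0 := by
    intro x hx
    apply disc_zero_of_circle_zero (fun y => f (x, y)) _ hσ
    · intro y hy
      exact (hf _ (hmem x y (by linarith) (by linarith))).differentiableAt.comp y
        (f := fun y => (x, y)) (by fun_prop)
    · intro y hy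
      exact hzero _ (hmem x y (by linarith) (by linarith)) (by simp [hx, hy])
  have h2 : ∀ y, ‖y‖ ≤ c * ρ ^ lam → ∀ x, ‖x‖ ≤ ρ → f (x, y) = 0 := by
    intro y hy
    apply disc_zero_of_circle_zero (fun x => f (x, y)) _ hρ
    · intro x hx
      exact (hf _ (hmem x y (by linarith) (by linarith))).differentiableAt.comp x
        (f := fun x => (x, y)) (by fun_prop)
    · intro x hx
      exact h1 x hx y hy
  have h3 : f =ᶠ[nhds ((0, 0) : ℂ × ℂ)] 0 := by
    filter_upwards [Metric.ball_mem_nhds ((0, 0) : ℂ × ℂ) (lt_min hρ hσ)] with z hz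
    rw [Metric.mem_ball, Prod.dist_eq] at hz
    have hz' := max_lt_iff.1 hz
    simp only [dist_zero_right, lt_min_iff] at hz'
    exact h2 z.2 hz'.2.2.le z.1 hz'.1.1.le
  exact fun z hz => hf.eqOn_zero_of_preconnected_of_eventuallyEq_zero hUconn.isPreconnected h0 h3 hz
end

section
/- Let λ > 0 be an irrational real number and let δ > 0. Then the set {(x,y) ∈ ℂ² : ∃ p q : ℕ, 0 < p ∧ 0 < q ∧ |(p : ℝ)/q − λ| < δ ∧ y^q = x^p} is dense in the set {(x,y) ∈ ℂ² : ‖y‖ = ‖x‖^λ}. -/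
open Filter Topology

/-- The algebraic curves `S_{p/q} = {y^q = x^p}` with `p/q` within `δ` of the
irrational number `λ > 0` are dense in the nodal separator `{‖y‖ = ‖x‖^λ}`. -/
theorem curves_dense_in_nodal_separator
    (lam : ℝ) (hlam : 0 < lam) (hirr : Irrational lam) (δ : ℝ) (hδ : 0 < δ) :
    {z : ℂ × ℂ | ‖z.2‖ = ‖z.1‖ ^ lam} ⊆
      closure {z : ℂ × ℂ | ∃ p q : ℕ, 0 < p ∧ 0 < q ∧
        |(p : ℝ) / (q : ℝ) - lam| < δ ∧ z.2 ^ q = z.1 ^ p} := by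
  rintro ⟨x, y⟩ hxy
  simp only [Set.mem_ofPred_eq] at hxy
  have hr : Tendsto (fun n : ℕ => ((⌈lam * (n : ℝ)⌉₊ : ℕ) : ℝ) / (n : ℝ)) atTop (𝓝 lam) :=
    (tendsto_nat_ceil_mul_div_atTop hlam.le).comp tendsto_natCast_atTop_atTop
  have hclose : ∀ᶠ n : ℕ in atTop,
      |((⌈lam * (n : ℝ)⌉₊ : ℕ) : ℝ) / (n : ℝ) - lam| < δ := by
    have := (Metric.tendsto_nhds.1 hr) δ hδ
    simpa only [Real.dist_eq] using this
  have hppos : ∀ n : ℕ, 0 < n → 0 < ⌈lam * (n : ℝ)⌉₊ := by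
    intro n hn
    have : (0 : ℝ) < n := by exact_mod_cast hn
    exact Nat.ceil_pos.2 (by positivity)
  by_cases hx : x = 0
  · subst hx
    have hy : y = 0 := by
      rw [norm_zero, Real.zero_rpow hlam.ne'] at hxy
      exact norm_eq_zero.1 hxy
    subst hy
    apply subset_closure
    obtain ⟨n, hn, hn0⟩ := (hclose.and (eventually_gt_atTop 0)).exists
    refine ⟨_, n, hppos n hn0, hn0, hn, ?_⟩
    simp only
    rw [zero_pow hn0.ne', zero_pow (hppos n hn0).ne']
  have hxn : 0 < ‖x‖ := norm_pos_iff.2 hx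
  have hy : y ≠ 0 := by
    rw [← norm_pos_iff, hxy]; positivity
  obtain ⟨a, rfl⟩ : ∃ a, Complex.exp a = x := ⟨_, Complex.exp_log hx⟩
  obtain ⟨b, rfl⟩ : ∃ b, Complex.exp b = y := ⟨_, Complex.exp_log hy⟩
  have hre : b.re = lam * a.re := by
    rw [Complex.norm_exp, Complex.norm_exp, ← Real.exp_mul] at hxy
    rw [Real.exp_injective hxy, mul_comm]
  have hpi := Real.pi_pos
  set r : ℕ → ℝ := fun n => ((⌈lam * (n : ℝ)⌉₊ : ℕ) : ℝ) / (n : ℝ) with hrdef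
  set c : ℕ → ℝ := fun n => (b.im - r n * a.im) / (2 * Real.pi) with hcdef
  set s : ℕ → ℝ := fun n => (⌊(n : ℝ) * c n⌋ : ℝ) / (n : ℝ) with hsdef
  have hc : Tendsto c atTop (𝓝 ((b.im - lam * a.im) / (2 * Real.pi))) :=
    (tendsto_const_nhds.sub (hr.mul_const _)).div_const _
  have hs : Tendsto s atTop (𝓝 ((b.im - lam * a.im) / (2 * Real.pi))) := by
    have h1 : Tendsto (fun n : ℕ => c n - 1 / (n : ℝ)) atTop
        (𝓝 ((b.im - lam * a.im) / (2 * Real.pi))) := by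
      simpa using hc.sub tendsto_one_div_atTop_nhds_zero_nat
    refine tendsto_of_tendsto_of_tendsto_of_le_of_le' h1 hc ?_ ?_
    · filter_upwards [eventually_gt_atTop 0] with n hn
      have hn' : (0 : ℝ) < n := by exact_mod_cast hn
      have := Int.lt_floor_add_one ((n : ℝ) * c n)
      rw [hsdef, le_div_iff₀ hn', sub_mul, one_div, inv_mul_cancel₀ hn'.ne']
      linarith
    · filter_upwards [eventually_gt_atTop 0] with n hn
      have hn' : (0 : ℝ) < n := by exact_mod_cast hn
      have := Int.floor_le ((n : ℝ) * c n)
      rw [hsdef, div_le_iff₀ hn']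
      linarith
  have hb : Tendsto (fun n => (r n : ℂ) * a + (s n : ℂ) * (2 * Real.pi * Complex.I)) atTop
      (𝓝 b) := by
    have h1 : Tendsto (fun n => (r n : ℂ)) atTop (𝓝 (lam : ℂ)) :=
      (Complex.continuous_ofReal.tendsto _).comp hr
    have h2 := (Complex.continuous_ofReal.tendsto _).comp hs
    have h3 := (h1.mul_const a).add (h2.mul_const (2 * Real.pi * Complex.I))
    have hbeq : (lam : ℂ) * a + (((b.im - lam * a.im) / (2 * Real.pi) : ℝ) : ℂ) *
        (2 * Real.pi * Complex.I) = b := by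
      have : (b.im - lam * a.im) / (2 * Real.pi) * (2 * Real.pi) = b.im - lam * a.im := by
        field_simp
      generalize (b.im - lam * a.im) / (2 * Real.pi) = t at this ⊢
      apply Complex.ext
      · simp [hre]
      · simp
        linarith
    rw [hbeq] at h3
    exact h3
  have hlim : Tendsto (fun n => (Complex.exp a,
      Complex.exp ((r n : ℂ) * a + (s n : ℂ) * (2 * Real.pi * Complex.I)))) atTop
      (𝓝 (Complex.exp a, Complex.exp b)) :=
    tendsto_const_nhds.prodMk_nhds ((Complex.continuous_exp.tendsto b).comp hb)
  refine mem_closure_of_tendsto hlim ?_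
  filter_upwards [hclose, eventually_gt_atTop 0] with n hn hn0
  refine ⟨_, n, hppos n hn0, hn0, hn, ?_⟩
  have hn' : (n : ℂ) ≠ 0 := by exact_mod_cast hn0.ne'
  rw [← Complex.exp_nat_mul, ← Complex.exp_nat_mul, Complex.exp_eq_exp_iff_exists_int]
  refine ⟨⌊(n : ℝ) * c n⌋, ?_⟩
  simp only [hrdef, hsdef]
  push_cast
  field_simp
end

section
/- Let λ > 0 be an irrational real number and let x₀, y₀ ∈ ℂ be nonzero. Then the closure in ℂ² of the set L = {(x₀·exp(s), y₀·exp(λ·s)) : s ∈ ℂ} (where λ·s is the product of the real number λ and the complex number s, and exp is the complex exponential) is exactly the set {(x,y) ∈ ℂ² : ‖y‖·‖x₀‖^λ = ‖y₀‖·‖x‖^λ}. -/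
/-- The closure of the leaf `L = {(x₀ e^s, y₀ e^{λs}) : s ∈ ℂ}` of the linear node
`-λ y dx + x dy = 0` (λ > 0 irrational, x₀, y₀ ≠ 0) is exactly
`{(x,y) : ‖y‖‖x₀‖^λ = ‖y₀‖‖x‖^λ}`. -/
theorem closure_of_nodal_leaf
    (lam : ℝ) (hlam : 0 < lam) (hirr : Irrational lam)
    (x₀ y₀ : ℂ) (hx₀ : x₀ ≠ 0) (hy₀ : y₀ ≠ 0) :
    closure {z : ℂ × ℂ | ∃ s : ℂ,
        z = (x₀ * Complex.exp s, y₀ * Complex.exp ((lam : ℂ) * s))} =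
      {z : ℂ × ℂ | ‖z.2‖ * ‖x₀‖ ^ lam = ‖y₀‖ * ‖z.1‖ ^ lam} := by
  have hnx : 0 < ‖x₀‖ := norm_pos_iff.mpr hx₀
  have hny : 0 < ‖y₀‖ := norm_pos_iff.mpr hy₀
  have hpow : 0 < ‖x₀‖ ^ lam := Real.rpow_pos_of_pos hnx _
  have key : ∀ s : ℂ, ‖y₀ * Complex.exp ((lam : ℂ) * s)‖ * ‖x₀‖ ^ lam
      = ‖y₀‖ * ‖x₀ * Complex.exp s‖ ^ lam := by
    intro s
    rw [norm_mul, norm_mul, Complex.norm_exp, Complex.norm_exp,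
      Real.mul_rpow hnx.le (Real.exp_pos _).le, ← Real.exp_mul, Complex.re_ofReal_mul,
      mul_comm lam]
    ring
  apply Set.Subset.antisymm
  · apply closure_minimal
    · rintro z ⟨s, rfl⟩
      exact key s
    · apply isClosed_eq
      · fun_prop
      · exact continuous_const.mul
          ((continuous_norm.comp continuous_fst).rpow_const (fun _ => Or.inr hlam.le))
  · rintro ⟨x, y⟩ h
    simp only [Set.mem_setOf_eq] at h
    by_cases hx : x = 0
    · subst hx
      rw [norm_zero, Real.zero_rpow hlam.ne', mul_zero] at h
      have hy : y = 0 := by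
        rcases mul_eq_zero.mp h with h | h
        · exact norm_eq_zero.mp h
        · exact absurd h hpow.ne'
      subst hy
      have h1 : Filter.Tendsto (fun t : ℝ => Complex.exp (t : ℂ)) Filter.atBot (nhds 0) := by
        apply Complex.tendsto_exp_comap_re_atBot.comp
        rw [Filter.tendsto_comap_iff]
        exact Filter.tendsto_id
      have h2 : Filter.Tendsto (fun t : ℝ => Complex.exp ((lam : ℂ) * (t : ℂ)))
          Filter.atBot (nhds 0) := by
        have := h1.comp (Filter.tendsto_id.const_mul_atBot hlam)
        refine this.congr fun t => ?_
        simp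
      have h3 := (h1.const_mul x₀).prodMk_nhds (h2.const_mul y₀)
      rw [mul_zero, mul_zero] at h3
      exact mem_closure_of_tendsto h3 (Filter.Eventually.of_forall fun t => ⟨(t : ℂ), rfl⟩)
    · set s₀ : ℂ := Complex.log (x / x₀) with hs
      have hs₀ : x₀ * Complex.exp s₀ = x := by
        rw [hs, Complex.exp_log (div_ne_zero hx hx₀)]
        field_simp
      have hk := key s₀
      rw [hs₀, ← h] at hk
      have hnorm := mul_right_cancel₀ hpow.ne' hk
      set w : ℂ := y₀ * Complex.exp ((lam : ℂ) * s₀) with hw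
      have hw0 : w ≠ 0 := mul_ne_zero hy₀ (Complex.exp_ne_zero _)
      have hq : ‖y / w‖ = 1 := by
        rw [norm_div, hnorm, div_self]
        rw [← hnorm]
        exact norm_ne_zero_iff.mpr hw0
      let f : ℝ → ℂ × ℂ := fun θ => (x, w * Complex.exp (2 * Real.pi * Complex.I * θ))
      have hf : Continuous f := by fun_prop
      obtain ⟨θ, hθ⟩ : ∃ θ : ℝ, f θ = (x, y) := by
        refine ⟨(y / w).arg / (2 * Real.pi), ?_⟩
        have h1 := Complex.norm_mul_exp_arg_mul_I (y / w)
        rw [hq, Complex.ofReal_one, one_mul] at h1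
        have h2 : (2 * Real.pi * Complex.I * (((y / w).arg / (2 * Real.pi) : ℝ) : ℂ))
            = (y / w).arg * Complex.I := by
          have : (Real.pi : ℂ) ≠ 0 := Complex.ofReal_ne_zero.mpr Real.pi_ne_zero
          push_cast
          field_simp
        simp only [f]
        rw [h2, h1, mul_div_cancel₀ _ hw0]
      have hd : Dense (AddSubgroup.closure {lam, 1} : Set ℝ) := by
        rw [dense_addSubgroupClosure_pair_iff, div_one]
        exact hirr
      rw [← hθ]
      refine map_mem_closure hf (hd θ) ?_
      intro t ht
      obtain ⟨n, m, rfl⟩ := AddSubgroup.mem_closure_pair.mp ht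
      refine ⟨s₀ + n * (2 * Real.pi * Complex.I), ?_⟩
      simp only [f]
      rw [Complex.exp_add, Complex.exp_int_mul_two_pi_mul_I, mul_one, hs₀, hw]
      congr 1
      rw [mul_assoc, ← Complex.exp_add]
      congr 1
      rw [Complex.exp_eq_exp_iff_exists_int]
      refine ⟨m, ?_⟩
      simp
      ring
end

section
/- Let λ > 0 be an irrational real number, let x₀, y₀ ∈ ℂ be nonzero, let U be a connected open neighborhood of (0,0) in ℂ², and let f : ℂ² → ℂ be complex analytic on U. Suppose that for every s ∈ ℂ with (x₀·exp(s), y₀·exp(λ·s)) ∈ U one has f(x₀·exp(s), y₀·exp(λ·s)) = f(0,0). Then f is constant (equal to f(0,0)) on U. -/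
open Filter Topology

theorem disc_zero_of_rotations (lam : ℝ) (hirr : Irrational lam) (r : ℝ) (h : ℂ → ℂ)
    (hh : AnalyticOnNhd ℂ h (Metric.ball 0 r)) (y₀ s : ℂ) (hy₀ : y₀ ≠ 0)
    (hr : ‖y₀ * Complex.exp (lam * s)‖ < r)
    (hz : ∀ k : ℕ, h (y₀ * Complex.exp (lam * (s + k * (2 * Real.pi * Complex.I)))) = 0) :
    ∀ y ∈ Metric.ball (0 : ℂ) r, h y = 0 := by
  set p : ℕ → ℂ := fun k => y₀ * Complex.exp (lam * (s + k * (2 * Real.pi * Complex.I))) with hp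
  have hinj : Function.Injective p := by
    intro a b hab
    have h1 := mul_left_cancel₀ hy₀ hab
    obtain ⟨n, hn⟩ := Complex.exp_eq_exp_iff_exists_int.1 h1
    have h2 : (2 * Real.pi * Complex.I : ℂ) * (lam * (a - b) - n) = 0 := by
      linear_combination hn
    have h3 : (lam * (a - b) - n : ℂ) = 0 :=
      (mul_eq_zero.1 h2).resolve_left Complex.two_pi_I_ne_zero
    have h4 : lam * (((a : ℤ) - (b : ℤ) : ℤ) : ℝ) = (n : ℝ) := by
      have : lam * ((a : ℝ) - b) - n = 0 := by exact_mod_cast h3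
      push_cast
      linarith
    by_contra hne
    have hd : ((a : ℤ) - (b : ℤ)) ≠ 0 := by omega
    exact (hirr.mul_intCast hd).ne_int n h4
  have hnorm : ∀ k, ‖p k‖ = ‖y₀ * Complex.exp (lam * s)‖ := by
    intro k
    simp [hp, Complex.norm_exp]
  have hsub : Set.range p ⊆ Metric.sphere 0 ‖y₀ * Complex.exp (lam * s)‖ := by
    rintro _ ⟨k, rfl⟩
    simpa using hnorm k
  obtain ⟨w, hw, hacc⟩ := (Set.infinite_range_of_injective hinj).exists_accPt_of_subset_isCompact
    (isCompact_sphere _ _) hsub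
  have hwb : w ∈ Metric.ball (0 : ℂ) r := by
    rw [mem_ball_zero_iff]
    rw [mem_sphere_zero_iff_norm] at hw
    rw [hw]; exact hr
  have hfreq : ∃ᶠ z in 𝓝[≠] w, h z = 0 := by
    refine (accPt_iff_frequently_nhdsNE.1 hacc).mono ?_
    rintro _ ⟨k, rfl⟩
    exact hz k
  exact hh.eqOn_zero_of_preconnected_of_frequently_eq_zero
    (convex_ball (0 : ℂ) r).isPreconnected hwb hfreq


/-- Propagation step: if a function holomorphic on a connected open neighborhood `U`
of the origin in `ℂ²` equals `f(0,0)` on the leaf `{(x₀ e^s, y₀ e^{λs}) : s ∈ ℂ}`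
(λ > 0 irrational, x₀, y₀ ≠ 0) wherever the leaf meets `U`, then `f` is constant on `U`. -/
theorem constant_on_nodal_leaf_implies_constant
    (lam : ℝ) (hlam : 0 < lam) (hirr : Irrational lam)
    (x₀ y₀ : ℂ) (hx₀ : x₀ ≠ 0) (hy₀ : y₀ ≠ 0)
    (U : Set (ℂ × ℂ)) (hUopen : IsOpen U) (hUconn : IsConnected U)
    (h0 : ((0, 0) : ℂ × ℂ) ∈ U)
    (f : ℂ × ℂ → ℂ) (hf : AnalyticOnNhd ℂ f U)
    (hleaf : ∀ s : ℂ,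
      (x₀ * Complex.exp s, y₀ * Complex.exp ((lam : ℂ) * s)) ∈ U →
      f (x₀ * Complex.exp s, y₀ * Complex.exp ((lam : ℂ) * s)) = f (0, 0)) :
    ∀ z ∈ U, f z = f (0, 0) := by
  obtain ⟨r, hr, hball⟩ := Metric.isOpen_iff.1 hUopen _ h0
  have hmem : ∀ x y : ℂ, ‖x‖ < r → ‖y‖ < r → (x, y) ∈ U := by
    intro x y hx hy
    apply hball
    rw [Metric.mem_ball, Prod.dist_eq]
    simpa using ⟨hx, hy⟩
  -- a point of the leaf close to the origin
  have hex : ∃ t : ℝ, ‖x₀ * Complex.exp (t : ℂ)‖ < r ∧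
      ‖y₀ * Complex.exp ((lam : ℂ) * t)‖ < r := by
    have e1 : Tendsto (fun t : ℝ => ‖x₀‖ * Real.exp t) atBot (𝓝 0) := by
      simpa using Real.tendsto_exp_atBot.const_mul ‖x₀‖
    have e2 : Tendsto (fun t : ℝ => ‖y₀‖ * Real.exp (lam * t)) atBot (𝓝 0) := by
      simpa using (Real.tendsto_exp_atBot.comp
        (tendsto_id.const_mul_atBot hlam)).const_mul ‖y₀‖
    obtain ⟨t, h1, h2⟩ :=
      ((e1.eventually_lt_const hr).and (e2.eventually_lt_const hr)).exists
    refine ⟨t, ?_, ?_⟩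
    · simpa [Complex.norm_exp] using h1
    · simpa [Complex.norm_exp] using h2
  obtain ⟨t, ht1, ht2⟩ := hex
  set x₁ : ℂ := x₀ * Complex.exp (t : ℂ) with hx₁
  have hx₁0 : x₁ ≠ 0 := mul_ne_zero hx₀ (Complex.exp_ne_zero _)
  have hcont : ContinuousAt (fun x : ℂ => ‖y₀ * Complex.exp ((lam : ℂ) * (t + Complex.log (x / x₁)))‖) x₁ := by
    have : ContinuousAt (fun x : ℂ => Complex.log (x / x₁)) x₁ := by
      apply ContinuousAt.clog
      · fun_prop
      · simp [div_self hx₁0]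
    fun_prop
  have ev1 : ∀ᶠ x in 𝓝 x₁, ‖y₀ * Complex.exp ((lam : ℂ) * (t + Complex.log (x / x₁)))‖ < r := by
    apply hcont.eventually_lt_const
    simpa [div_self hx₁0] using ht2
  have ev2 : ∀ᶠ x in 𝓝 x₁, ‖x‖ < r := continuous_norm.continuousAt.eventually_lt_const ht1
  have ev3 : ∀ᶠ x in 𝓝 x₁, x ≠ 0 := eventually_ne_nhds hx₁0
  have key : ∀ᶠ x in 𝓝 x₁, ∀ y ∈ Metric.ball (0 : ℂ) r, f (x, y) = f (0, 0) := by
    filter_upwards [ev1, ev2, ev3] with x h1 h2 h3 y hy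
    have hes : ∀ k : ℕ, x₀ * Complex.exp ((t + Complex.log (x / x₁)) +
        k * (2 * Real.pi * Complex.I)) = x := by
      intro k
      rw [Complex.exp_add, Complex.exp_nat_mul_two_pi_mul_I, Complex.exp_add,
        Complex.exp_log (div_ne_zero h3 hx₁0), mul_one, ← mul_assoc, ← hx₁]
      field_simp
    have := disc_zero_of_rotations lam hirr r (fun y => f (x, y) - f (0, 0)) ?_ y₀
      (t + Complex.log (x / x₁)) hy₀ h1 ?_ y hy
    · exact sub_eq_zero.1 this
    · intro w hw
      have hfw := hf (x, w) (hmem x w h2 (by simpa using hw))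
      have hg : AnalyticAt ℂ (fun y : ℂ => (x, y)) w := by fun_prop
      exact (AnalyticAt.comp' (g := f) hfw hg).sub analyticAt_const
    · intro k
      have hk := hleaf ((t + Complex.log (x / x₁)) + k * (2 * Real.pi * Complex.I))
      rw [hes k] at hk
      refine sub_eq_zero.2 (hk (hmem _ _ h2 ?_))
      refine lt_of_eq_of_lt ?_ h1
      simp [Complex.norm_exp]
  have hev : f =ᶠ[𝓝 (x₁, (0 : ℂ))] fun _ => f (0, 0) := by
    rw [nhds_prod_eq]
    filter_upwards [key.prod_mk (Metric.ball_mem_nhds (0 : ℂ) hr)] with z hz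
    exact hz.1 z.2 hz.2
  exact hf.eqOn_of_preconnected_of_eventuallyEq analyticOnNhd_const hUconn.isPreconnected
    (hmem x₁ 0 ht1 (by simpa using hr)) hev
end
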